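/- arXiv:1612.05040 — 2 statements merged into one kernel-verified Lean document; each statement's English description precedes it below -/
import Mathlib

section
/- Let n ≥ 1 and let A = Circulant(a_0,…,a_{n−1}) ∈ ℝ≥0^{n×n} be a nonzero circulant matrix. Define per(A) as the least σ ≥ 1 for which there exists T such that (A/λ(A))^{t+σ} = (A/λ(A))^t for all t ≥ T (such a σ exists). If a_0 = λ(A), then per(A) = 1. If a_0 ≠ λ(A), then the set P = {p ∈ {1,…,n−1} : a_p = λ(A)} is nonempty, and writing its elements as p_1 > p_2 > … > p_s, one has per(A) = gcd( n/gcd(n,p_1), (p_1−p_2)/gcd(p_1,p_2), (p_1−p_3)/gcd(p_1,p_3), …, (p_1−p_s)/gcd(p_1,p_s) ). -/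
open scoped NNReal Classical

namespace MaxAlg

variable {n : ℕ}

/-- cyclic successor on `Fin k` -/
def cyc {k : ℕ} (l : Fin k) : Fin k := ⟨(l.val + 1) % k, Nat.mod_lt _ l.pos⟩

/-- max-algebraic matrix product -/
noncomputable def mmul (A B : Matrix (Fin n) (Fin n) ℝ≥0) : Matrix (Fin n) (Fin n) ℝ≥0 :=
  fun i k => Finset.univ.sup fun j => A i j * B j k

/-- max-algebraic identity matrix -/
def mId (n : ℕ) : Matrix (Fin n) (Fin n) ℝ≥0 := fun i j => if i = j then 1 else 0

/-- max-algebraic matrix power -/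
noncomputable def mpow (A : Matrix (Fin n) (Fin n) ℝ≥0) : ℕ → Matrix (Fin n) (Fin n) ℝ≥0
  | 0 => mId n
  | t + 1 => mmul (mpow A t) A

/-- max-algebraic matrix-vector product -/
noncomputable def mvec (A : Matrix (Fin n) (Fin n) ℝ≥0) (x : Fin n → ℝ≥0) : Fin n → ℝ≥0 :=
  fun i => Finset.univ.sup fun j => A i j * x j

/-- geometric mean of the cycle `c` of length `k` -/
noncomputable def cycMean (A : Matrix (Fin n) (Fin n) ℝ≥0) (k : ℕ) (c : Fin k → Fin n) : ℝ≥0 :=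
  (∏ l : Fin k, A (c l) (c (cyc l))) ^ ((1 : ℝ) / (k : ℝ))

/-- maximum cycle geometric mean λ(A) -/
noncomputable def lam (A : Matrix (Fin n) (Fin n) ℝ≥0) : ℝ≥0 :=
  (Finset.Icc 1 n).sup fun k => Finset.univ.sup fun c : Fin k → Fin n => cycMean A k c

/-- attraction cone Attr(A) -/
def Attr (A : Matrix (Fin n) (Fin n) ℝ≥0) : Set (Fin n → ℝ≥0) :=
  {x | ∃ s : ℕ, mvec (mpow A (s + 1)) x = fun i => lam A * mvec (mpow A s) x i}

/-- circulant matrix built from the vector of values `a_0, …, a_{n-1}` -/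
def circ (a : Fin n → ℝ≥0) : Matrix (Fin n) (Fin n) ℝ≥0 := fun i j => a (j - i)

/-- A is a circulant matrix -/
def IsCirculant (A : Matrix (Fin n) (Fin n) ℝ≥0) : Prop := ∃ a : Fin n → ℝ≥0, A = circ a

/-- (i,j) is a critical edge of A -/
def IsCritEdge (A : Matrix (Fin n) (Fin n) ℝ≥0) (i j : Fin n) : Prop :=
  A i j ≠ 0 ∧ ∃ (k : ℕ) (c : Fin k → Fin n), 1 ≤ k ∧
    (∀ l, A (c l) (c (cyc l)) ≠ 0) ∧
    cycMean A k c = lam A ∧ ∃ l, c l = i ∧ c (cyc l) = j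

/-- there is a walk of length ≥ 1 from i to j in crit(A) -/
def CritWalk (A : Matrix (Fin n) (Fin n) ℝ≥0) (i j : Fin n) : Prop :=
  ∃ l : ℕ, 1 ≤ l ∧ ∃ w : ℕ → Fin n, w 0 = i ∧ w l = j ∧
    ∀ r < l, IsCritEdge A (w r) (w (r + 1))

/-- node i lies on a critical cycle of A -/
def OnCritCycle (A : Matrix (Fin n) (Fin n) ℝ≥0) (i : Fin n) : Prop :=
  ∃ (k : ℕ) (c : Fin k → Fin n), 1 ≤ k ∧
    (∀ l, A (c l) (c (cyc l)) ≠ 0) ∧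
    cycMean A k c = lam A ∧ ∃ l, c l = i

/-- family of one-dimensional intervals with bounds `lo`, `hi`,
each of one of the four forms -/
def IsIntervalFam (S : Fin n → Set ℝ≥0) (lo hi : Fin n → ℝ≥0) : Prop :=
  ∀ i, (S i).Nonempty ∧
    (S i = Set.Icc (lo i) (hi i) ∨ S i = Set.Ico (lo i) (hi i) ∨
     S i = Set.Ioc (lo i) (hi i) ∨ S i = Set.Ioo (lo i) (hi i))

/-- the interval 𝐗 ⊆ ℝ≥0ⁿ determined by the family S -/
def box (S : Fin n → Set ℝ≥0) : Set (Fin n → ℝ≥0) := {x | ∀ i, x i ∈ S i}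

/-- vertex x^{(k)}: x̄ in coordinate k and x̲ elsewhere -/
def vtx (lo hi : Fin n → ℝ≥0) (k : Fin n) : Fin n → ℝ≥0 :=
  Function.update lo k (hi k)

/-- the interval circulant matrix C(𝐚) determined by the interval family Sa -/
def Cset (Sa : Fin n → Set ℝ≥0) : Set (Matrix (Fin n) (Fin n) ℝ≥0) :=
  {A | ∃ a : Fin n → ℝ≥0, (∀ k, a k ∈ Sa k) ∧ A = circ a}

/-- the matrix Â, with â_k = min(a̲, ā_k) where a̲ = max_k a̲_k -/
noncomputable def Ahat (alo ahi : Fin n → ℝ≥0) : Matrix (Fin n) (Fin n) ℝ≥0 :=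
  circ fun k => min (Finset.univ.sup alo) (ahi k)

/-- the matrix A^{(k)} = Circulant(a̲_0,…,a̲_{k−1}, ā_k, a̲_{k+1},…,a̲_{n−1}) -/
def Ak (alo ahi : Fin n → ℝ≥0) (k : Fin n) : Matrix (Fin n) (Fin n) ℝ≥0 :=
  circ (Function.update alo k (ahi k))

end MaxAlg
namespace MaxAlg

/-- max-algebraic convolution powers of a function on `Fin n`: the first rows of the powers of
the circulant matrix of `b` -/
noncomputable def convPow {n : ℕ} [NeZero n] (b : Fin n → ℝ≥0) : ℕ → Fin n → ℝ≥0
  | 0 => fun x => if x = 0 then 1 else 0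
  | t + 1 => fun x => Finset.univ.sup fun y => convPow b t y * b (x - y)

section ConvPow

variable {n : ℕ} [NeZero n] {b : Fin n → ℝ≥0}

theorem mpow_circ (b : Fin n → ℝ≥0) (t : ℕ) : mpow (circ b) t = circ (convPow b t) := by
  induction t with
  | zero =>
    ext i j
    simp [mpow, mId, circ, convPow, sub_eq_zero, eq_comm]
  | succ t ih =>
    ext i j
    simp only [mpow, mmul, ih, circ, convPow]
    congr 1
    apply le_antisymm
    · refine Finset.sup_le fun k _ => ?_
      have h := Finset.le_sup (f := fun y => convPow b t y * b (j - i - y))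
        (Finset.mem_univ (k - i))
      simpa only [sub_sub_sub_cancel_right] using h
    · refine Finset.sup_le fun y _ => ?_
      have h := Finset.le_sup (f := fun k => convPow b t (k - i) * b (j - k))
        (Finset.mem_univ (y + i))
      have e : j - (y + i) = j - i - y := by abel
      simpa only [add_sub_cancel_right, e] using h

theorem circ_injective : Function.Injective (circ : (Fin n → ℝ≥0) → _) := by
  intro f g h
  ext x
  have := congrFun (congrFun h 0) x
  simpa [circ] using congrArg NNReal.toReal this

theorem convPow_mul_le (b : Fin n → ℝ≥0) (t : ℕ) (x p : Fin n) :
    convPow b t x * b p ≤ convPow b (t + 1) (x + p) := by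
  have h := Finset.le_sup (f := fun y => convPow b t y * b (x + p - y)) (Finset.mem_univ x)
  simp only [add_sub_cancel_left] at h
  exact h

theorem exists_convPow_succ_eq (b : Fin n → ℝ≥0) (t : ℕ) (x : Fin n) :
    ∃ y, convPow b (t + 1) x = convPow b t y * b (x - y) := by
  obtain ⟨y, -, hy⟩ := Finset.exists_mem_eq_sup (Finset.univ : Finset (Fin n)) ⟨0, by simp⟩
    (fun y => convPow b t y * b (x - y))
  exact ⟨y, hy⟩

theorem convPow_le_one (hb : ∀ p, b p ≤ 1) (t : ℕ) (x : Fin n) : convPow b t x ≤ 1 := by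
  induction t generalizing x with
  | zero => simp only [convPow]; split_ifs <;> simp
  | succ t ih => exact Finset.sup_le fun y _ => mul_le_one' (ih y) (hb _)

theorem prod_map_le_convPow (b : Fin n → ℝ≥0) (s : Multiset (Fin n)) :
    (s.map b).prod ≤ convPow b s.card s.sum := by
  induction s using Multiset.induction with
  | empty => simp [convPow]
  | cons p s ih =>
    rw [Multiset.map_cons, Multiset.prod_cons, Multiset.card_cons, Multiset.sum_cons, mul_comm,
      add_comm p]
    exact (mul_le_mul_left ih _).trans (convPow_mul_le b _ _ _)

theorem convPow_eq_zero_or_exists_prod (b : Fin n → ℝ≥0) (t : ℕ) (x : Fin n) :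
    convPow b t x = 0 ∨
      ∃ s : Multiset (Fin n), s.card = t ∧ s.sum = x ∧ convPow b t x = (s.map b).prod := by
  induction t generalizing x with
  | zero =>
    by_cases hx : x = 0
    · exact Or.inr ⟨0, by simp [convPow, hx]⟩
    · exact Or.inl (by simp [convPow, hx])
  | succ t ih =>
    obtain ⟨y, hy⟩ := exists_convPow_succ_eq b t x
    rcases ih y with h | ⟨s, hc, hs, h⟩
    · exact Or.inl (by rw [hy, h, zero_mul])
    · refine Or.inr ⟨(x - y) ::ₘ s, by simp [hc], by simp [hs], ?_⟩
      rw [hy, h, Multiset.map_cons, Multiset.prod_cons, mul_comm]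

theorem card_nsmul_fin (p : Fin n) : n • p = 0 := by
  simpa using card_nsmul_eq_zero (x := p)

theorem exists_le_count {s : Multiset (Fin n)} (hs : n * n ≤ s.card) : ∃ p, n ≤ s.count p := by
  by_contra! h
  have h1 : ∑ p : Fin n, s.count p = s.card := Multiset.sum_count_eq_card fun _ _ => by simp
  have h2 : ∑ p : Fin n, s.count p < ∑ _p : Fin n, n :=
    Finset.sum_lt_sum_of_nonempty ⟨0, by simp⟩ fun p _ => h p
  simp at h2
  omega

theorem convPow_add_le (hb : ∀ p, b p ≤ 1) {t : ℕ} (ht : n * n ≤ t) (x : Fin n) :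
    convPow b (t + n) x ≤ convPow b t x := by
  rcases convPow_eq_zero_or_exists_prod b (t + n) x with h | ⟨s, hc, hs, h⟩
  · simp [h]
  · obtain ⟨p, hp⟩ := exists_le_count (s := s) (by omega)
    obtain ⟨r, rfl⟩ := Multiset.le_iff_exists_add.1 (Multiset.le_count_iff_replicate_le.1 hp)
    have hr : r.card = t := by simp at hc; omega
    have hrs : r.sum = x := by simpa [card_nsmul_fin] using hs
    rw [h, ← hr, ← hrs, Multiset.map_add, Multiset.prod_add, Multiset.map_replicate,
      Multiset.prod_replicate]
    exact (mul_le_of_le_one_left' (pow_le_one' (hb p) n)).trans (prod_map_le_convPow b r)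

theorem convPow_le_add_nsmul {p : Fin n} (hp : b p = 1) (t k : ℕ) (x : Fin n) :
    convPow b t x ≤ convPow b (t + k) (x + k • p) := by
  induction k with
  | zero => simp
  | succ k ih =>
    have h := convPow_mul_le b (t + k) (x + k • p) p
    rw [hp, mul_one] at h
    rw [succ_nsmul, ← add_assoc, ← add_assoc]
    exact ih.trans h

theorem convPow_add_nsmul (hb : ∀ p, b p ≤ 1) {p : Fin n} (hp : b p = 1) {t : ℕ}
    (ht : n * n ≤ t) (k : ℕ) (x : Fin n) : convPow b (t + k) (x + k • p) = convPow b t x := by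
  induction k with
  | zero => simp
  | succ k ih =>
    rw [← ih]
    apply le_antisymm
    · refine le_trans ?_ (convPow_add_le hb (t := t + k) (by omega) _)
      have hn := NeZero.one_le (n := n)
      have h := convPow_le_add_nsmul hp (t + (k + 1)) (n - 1) (x + (k + 1) • p)
      have e : x + (k + 1) • p + (n - 1) • p = x + k • p := by
        rw [add_assoc, ← add_nsmul, show k + 1 + (n - 1) = k + n by omega, add_nsmul,
          card_nsmul_fin, add_zero]
      rwa [e, show t + (k + 1) + (n - 1) = t + k + n by omega] at h
    · have h := convPow_le_add_nsmul hp (t + k) 1 (x + k • p)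
      rwa [one_nsmul, add_assoc x, ← succ_nsmul] at h

/-- translations of `Fin n` under which all late convolution powers are invariant -/
def lateStabilizer (b : Fin n → ℝ≥0) : AddSubgroup (Fin n) where
  carrier := {z | ∀ t ≥ n * n, ∀ x, convPow b t (x + z) = convPow b t x}
  zero_mem' := by simp
  add_mem' := by
    intro y z hy hz t ht x
    rw [← add_assoc, hz t ht, hy t ht]
  neg_mem' := by
    intro z hz t ht x
    rw [← hz t ht, neg_add_cancel_right]

theorem sub_mem_lateStabilizer (hb : ∀ p, b p ≤ 1) {p q : Fin n} (hp : b p = 1) (hq : b q = 1) :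
    p - q ∈ lateStabilizer b := by
  intro t ht x
  have h1 := convPow_add_nsmul hb hq ht 1 (x + (p - q))
  have h2 := convPow_add_nsmul hb hp ht 1 x
  rw [one_nsmul] at h1 h2
  rw [← h1, ← h2, add_assoc, sub_add_cancel]

theorem convPow_add_of_nsmul_mem (hb : ∀ p, b p ≤ 1) {p : Fin n} (hp : b p = 1) {k : ℕ}
    (hk : k • p ∈ lateStabilizer b) {t : ℕ} (ht : n * n ≤ t) :
    convPow b (t + k) = convPow b t := by
  funext x
  rw [← convPow_add_nsmul hb hp ht k x, hk (t + k) (by omega) x]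

theorem modEq_of_convPow_eq_one (hb : ∀ p, b p ≤ 1) {N r : ℕ} (hN : N ∣ n)
    (hS : ∀ p, b p = 1 → (p : ℕ) ≡ r [MOD N]) {t : ℕ} {x : Fin n} (h : convPow b t x = 1) :
    (x : ℕ) ≡ t * r [MOD N] := by
  induction t generalizing x with
  | zero =>
    have : x = 0 := by
      by_contra hx
      simp [convPow, hx] at h
    simpa [this] using Nat.ModEq.refl 0
  | succ t ih =>
    obtain ⟨y, hy⟩ := exists_convPow_succ_eq b t x
    rw [h] at hy
    have h1 : convPow b t y = 1 :=
      le_antisymm (convPow_le_one hb t y) (hy.le.trans (mul_le_of_le_one_right' (hb _)))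
    have h2 : b (x - y) = 1 := by rwa [h1, one_mul, eq_comm] at hy
    have hx : (x : ℕ) ≡ y + (x - y : Fin n) [MOD n] := by
      have e := congrArg Fin.val (add_sub_cancel y x)
      rw [Fin.val_add] at e
      rw [← e]
      exact Nat.mod_modEq _ _
    rw [add_one_mul]
    exact (hx.of_dvd hN).trans ((ih h1).add (hS _ h2))

theorem val_nsmul_one (k : ℕ) : ((k • (1 : Fin n) : Fin n) : ℕ) = k % n := by
  induction k with
  | zero => simp
  | succ k ih => rw [succ_nsmul, Fin.val_add, ih, Fin.val_one', ← Nat.add_mod]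

theorem nsmul_one_val (p : Fin n) : (p : ℕ) • (1 : Fin n) = p :=
  Fin.ext ((val_nsmul_one _).trans (Nat.mod_eq_of_lt p.isLt))

theorem div_gcd_nsmul_fin (m : Fin n) : (n / Nat.gcd n m) • m = 0 := by
  have e : n / Nat.gcd n m * m = n * (m / Nat.gcd n m) := by
    rw [← Nat.mul_div_assoc _ (Nat.gcd_dvd_right _ _), Nat.div_mul_right_comm (Nat.gcd_dvd_left _ _)]
  calc (n / Nat.gcd n m) • m = (n / Nat.gcd n m * m) • (1 : Fin n) := by
        rw [mul_nsmul', nsmul_one_val]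
    _ = 0 := by rw [e, mul_nsmul, card_nsmul_fin, nsmul_zero]

theorem sub_div_gcd_nsmul_fin {m p : Fin n} (hle : (p : ℕ) ≤ m) :
    (((m : ℕ) - p) / Nat.gcd m p) • m = ((m : ℕ) / Nat.gcd m p) • (m - p) := by
  have e : ((m : ℕ) - p) / Nat.gcd m p * m = (m : ℕ) / Nat.gcd m p * (m - p) := by
    rw [Nat.div_mul_right_comm (Nat.dvd_sub (Nat.gcd_dvd_left _ _) (Nat.gcd_dvd_right _ _)),
      Nat.div_mul_right_comm (Nat.gcd_dvd_left _ _), mul_comm]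
  have hsub : ((m : ℕ) - p) • (1 : Fin n) = m - p := by
    rw [sub_nsmul _ hle, nsmul_one_val, nsmul_one_val, sub_eq_add_neg]
  calc (((m : ℕ) - p) / Nat.gcd m p) • m
      = (((m : ℕ) - p) / Nat.gcd m p * m) • (1 : Fin n) := by rw [mul_nsmul', nsmul_one_val]
    _ = ((m : ℕ) / Nat.gcd m p) • (m - p) := by rw [e, mul_nsmul', hsub]

/-- gcd formula for the period, attached to a set `P` of critical indices and `m ∈ P` -/
def gcdPeriod (P : Finset (Fin n)) (m : Fin n) : ℕ :=
  Nat.gcd (n / Nat.gcd n m)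
    ((P.erase m).gcd fun p => ((m : ℕ) - (p : ℕ)) / Nat.gcd (m : ℕ) (p : ℕ))

theorem gcdPeriod_pos (P : Finset (Fin n)) (m : Fin n) : 0 < gcdPeriod P m :=
  Nat.gcd_pos_of_pos_left _ (Nat.div_pos (Nat.gcd_le_left _ (NeZero.pos n))
    (Nat.gcd_pos_of_pos_left _ (NeZero.pos n)))

theorem gcdPeriod_nsmul_mem {P : Finset (Fin n)} {m : Fin n} (hmax : ∀ p ∈ P, p ≤ m)
    {H : AddSubgroup (Fin n)} (hH : ∀ p ∈ P, m - p ∈ H) : gcdPeriod P m • m ∈ H := by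
  obtain ⟨g, hg⟩ := Int.subgroup_cyclic (H.comap (zmultiplesHom (Fin n) m))
  have key (k : ℕ) : k • m ∈ H ↔ g ∣ (k : ℤ) := by
    rw [← Int.mem_zmultiples_iff, AddSubgroup.zmultiples_eq_closure, ← hg]
    simp
  rw [key, ← Int.natAbs_dvd_natAbs, Int.natAbs_natCast]
  refine Nat.dvd_gcd ?_ (Finset.dvd_gcd fun p hp => ?_)
  · rw [← Int.natAbs_natCast (_ / _), Int.natAbs_dvd_natAbs, ← key]
    rw [div_gcd_nsmul_fin]
    exact H.zero_mem
  · rw [← Int.natAbs_natCast (_ / _), Int.natAbs_dvd_natAbs, ← key]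
    have hpP := Finset.mem_of_mem_erase hp
    have hle : (p : ℕ) ≤ m := hmax p hpP
    rw [sub_div_gcd_nsmul_fin hle]
    exact H.nsmul_mem (hH p hpP) _

theorem gcdPeriod_dvd {P : Finset (Fin n)} {m : Fin n} (hm : m ∈ P) (hmax : ∀ p ∈ P, p ≤ m) :
    ∃ N, N ∣ n ∧ (∀ p ∈ P, (p : ℕ) ≡ m [MOD N]) ∧ ∀ σ, N ∣ σ * m → gcdPeriod P m ∣ σ := by
  set G := gcdPeriod P m with hG
  set d := Nat.gcd n (P.gcd fun p => (p : ℕ)) with hd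
  have hd0 : 0 < d := Nat.gcd_pos_of_pos_left _ (NeZero.pos n)
  have hdn : d ∣ n := Nat.gcd_dvd_left _ _
  have hdp (p) (hp : p ∈ P) : d ∣ (p : ℕ) := (Nat.gcd_dvd_right _ _).trans (Finset.gcd_dvd hp)
  have hNn : G * d ∣ n :=
    (mul_dvd_mul (Nat.gcd_dvd_left _ _) (Nat.dvd_gcd hdn (hdp m hm))).trans
      (Nat.div_mul_cancel (Nat.gcd_dvd_left _ _)).dvd
  have hNp (p) (hp : p ∈ P) : G * d ∣ (m : ℕ) - p := by
    by_cases hpm : p = m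
    · simp [hpm]
    · have h1 : G ∣ ((m : ℕ) - p) / Nat.gcd m p :=
        (Nat.gcd_dvd_right _ _).trans (Finset.gcd_dvd (Finset.mem_erase.2 ⟨hpm, hp⟩))
      exact (mul_dvd_mul h1 (Nat.dvd_gcd (hdp m hm) (hdp p hp))).trans
        (Nat.div_mul_cancel (Nat.dvd_sub (Nat.gcd_dvd_left _ _) (Nat.gcd_dvd_right _ _))).dvd
  refine ⟨G * d, hNn, fun p hp => (Nat.modEq_iff_dvd' (hmax p hp)).2 (hNp p hp), fun σ hσ => ?_⟩
  obtain ⟨c, hc⟩ := hdp m hm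
  have hcop : Nat.Coprime G c := by
    set q := Nat.gcd G c with hq
    have hqG : q * d ∣ G * d := mul_dvd_mul_right (Nat.gcd_dvd_left _ _) d
    have hqm : q * d ∣ m := by
      rw [hc, mul_comm d]
      exact mul_dvd_mul_right (Nat.gcd_dvd_right _ _) d
    have hqd : q * d ∣ d := Nat.dvd_gcd (hqG.trans hNn) <| Finset.dvd_gcd fun p hp =>
      (Nat.dvd_sub_iff_right (hmax p hp) hqm).1 (hqG.trans (hNp p hp))
    exact Nat.dvd_one.1 (Nat.dvd_of_mul_dvd_mul_right hd0 (by simpa using hqd))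
  refine hcop.dvd_of_dvd_mul_right (Nat.dvd_of_mul_dvd_mul_right hd0 ?_)
  rwa [mul_assoc, mul_comm c, ← hc]

theorem dvd_of_eventually_convPow_add_eq (hb : ∀ p, b p ≤ 1) {P : Finset (Fin n)}
    (hP : ∀ p, b p = 1 ↔ p ∈ P) {m : Fin n} (hm : m ∈ P) (hmax : ∀ p ∈ P, p ≤ m) {σ T : ℕ}
    (hσ : ∀ t ≥ T, convPow b (t + σ) = convPow b t) : gcdPeriod P m ∣ σ := by
  obtain ⟨N, hNn, hNP, hN⟩ := gcdPeriod_dvd hm hmax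
  have hT : T ≤ n * T := Nat.le_mul_of_pos_left T (NeZero.pos n)
  have h0 : convPow b (n * T) 0 = 1 := by
    refine le_antisymm (convPow_le_one hb _ _) ?_
    have h := convPow_le_add_nsmul ((hP m).2 hm) 0 (n * T) 0
    rw [zero_add, zero_add, mul_nsmul, card_nsmul_fin, nsmul_zero] at h
    simpa [convPow] using h
  have h1 : convPow b (n * T + σ) 0 = 1 := by rw [hσ _ hT, h0]
  have h := modEq_of_convPow_eq_one hb hNn (fun p hp => hNP p ((hP p).1 hp)) h1
  have h2 : N ∣ (n * T + σ) * m := (Nat.modEq_zero_iff_dvd).1 (by simpa using h.symm)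
  rw [add_mul] at h2
  exact hN σ ((Nat.dvd_add_right ((hNn.mul_right T).mul_right _)).1 h2)

end ConvPow

section Lam

variable {n : ℕ}

theorem lam_circ_le {a : Fin n → ℝ≥0} {M : ℝ≥0} (hM : ∀ p, a p ≤ M) : lam (circ a) ≤ M := by
  refine Finset.sup_le fun k hk => Finset.sup_le fun c _ => ?_
  have hk0 : k ≠ 0 := by have := (Finset.mem_Icc.1 hk).1; omega
  have h : ∏ l : Fin k, circ a (c l) (c (cyc l)) ≤ M ^ k := by
    simpa [circ] using Finset.prod_le_pow_card Finset.univ _ M fun l _ => hM (c (cyc l) - c l)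
  rw [cycMean, one_div, ← NNReal.pow_rpow_inv_natCast M hk0]
  exact NNReal.rpow_le_rpow h (by positivity)

variable [NeZero n]

theorem le_lam_circ (a : Fin n → ℝ≥0) (p : Fin n) : a p ≤ lam (circ a) := by
  have hn := NeZero.pos n
  set c : Fin n → Fin n := fun l => (l : ℕ) • p with hc
  have hcyc (l : Fin n) : c (cyc l) - c l = p := by
    have h : (((l : ℕ) + 1) % n) • p = ((l : ℕ) + 1) • p := by
      conv_rhs => rw [← Nat.mod_add_div ((l : ℕ) + 1) n, add_nsmul, mul_nsmul, card_nsmul_fin,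
        nsmul_zero, add_zero]
    simp only [hc, cyc, h, succ_nsmul, add_sub_cancel_left]
  have hmean : cycMean (circ a) n c = a p := by
    simp only [cycMean, circ, hcyc, Finset.prod_const, Finset.card_univ, Fintype.card_fin,
      one_div]
    exact NNReal.pow_rpow_inv_natCast _ hn.ne'
  rw [← hmean]
  exact (Finset.le_sup (f := fun c : Fin n → Fin n => cycMean (circ a) n c)
    (Finset.mem_univ c)).trans
    (Finset.le_sup (f := fun k => Finset.univ.sup fun c : Fin k → Fin n => cycMean (circ a) k c)
      (Finset.mem_Icc.2 ⟨hn, le_rfl⟩))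

theorem exists_eq_lam_circ (a : Fin n → ℝ≥0) : ∃ p, a p = lam (circ a) := by
  obtain ⟨p, hp⟩ := Finite.exists_max a
  exact ⟨p, le_antisymm (le_lam_circ a p) (lam_circ_le hp)⟩

theorem lam_circ_ne_zero {a : Fin n → ℝ≥0} (hA : circ a ≠ 0) : lam (circ a) ≠ 0 := by
  refine fun h => hA ?_
  ext i j
  simpa [h, circ] using le_lam_circ a (j - i)

end Lam

end MaxAlg

open MaxAlg in
/-- formula for the ultimate period `per(A)` of a nonzero circulant matrix. -/
theorem per_circulant
    (n : ℕ) (hn : 1 ≤ n) (a : Fin n → ℝ≥0) (hA : circ a ≠ 0)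
    (per : ℕ) (hper1 : 1 ≤ per)
    (hper2 : ∃ T : ℕ, ∀ t ≥ T,
      mpow (fun i j => circ a i j / lam (circ a)) (t + per) =
        mpow (fun i j => circ a i j / lam (circ a)) t)
    (hmin : ∀ σ : ℕ, 1 ≤ σ →
      (∃ T : ℕ, ∀ t ≥ T,
        mpow (fun i j => circ a i j / lam (circ a)) (t + σ) =
          mpow (fun i j => circ a i j / lam (circ a)) t) → per ≤ σ) :
    (a ⟨0, hn⟩ = lam (circ a) → per = 1) ∧
    (a ⟨0, hn⟩ ≠ lam (circ a) →
      ∃ hP : (Finset.univ.filter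
          (fun p : Fin n => (p : ℕ) ≠ 0 ∧ a p = lam (circ a))).Nonempty,
        per = Nat.gcd
          (n / Nat.gcd n
            (((Finset.univ.filter
                (fun p : Fin n => (p : ℕ) ≠ 0 ∧ a p = lam (circ a))).max' hP : Fin n) : ℕ))
          (((Finset.univ.filter
              (fun p : Fin n => (p : ℕ) ≠ 0 ∧ a p = lam (circ a))).erase
                ((Finset.univ.filter
                  (fun p : Fin n => (p : ℕ) ≠ 0 ∧ a p = lam (circ a))).max' hP)).gcd
            (fun p =>
              ((((Finset.univ.filter
                  (fun p : Fin n => (p : ℕ) ≠ 0 ∧ a p = lam (circ a))).max' hP : Fin n) : ℕ)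
                  - (p : ℕ)) /
                Nat.gcd
                  ((((Finset.univ.filter
                    (fun p : Fin n => (p : ℕ) ≠ 0 ∧ a p = lam (circ a))).max' hP : Fin n) : ℕ))
                  (p : ℕ)))) := by
  have : NeZero n := ⟨by omega⟩
  have hl := lam_circ_ne_zero hA
  set b : Fin n → ℝ≥0 := fun p => a p / lam (circ a) with hbdef
  have hb (p) : b p ≤ 1 := div_le_one_of_le₀ (le_lam_circ a p) zero_le
  have hb1 (p) : b p = 1 ↔ a p = lam (circ a) := div_eq_one_iff_eq hl
  have hmat : (fun i j => circ a i j / lam (circ a)) = circ b := rfl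
  simp only [hmat, mpow_circ, circ_injective.eq_iff] at hper2 hmin
  constructor
  · intro h0
    refine le_antisymm (hmin 1 le_rfl ⟨n * n, fun t ht => ?_⟩) hper1
    refine convPow_add_of_nsmul_mem hb ((hb1 ⟨0, hn⟩).2 h0) ?_ ht
    rw [one_nsmul]
    exact (lateStabilizer b).zero_mem
  · intro h0
    set P := Finset.univ.filter (fun p : Fin n => (p : ℕ) ≠ 0 ∧ a p = lam (circ a)) with hPdef
    have hP (p) : b p = 1 ↔ p ∈ P := by
      rw [hb1, hPdef, Finset.mem_filter]
      refine ⟨fun h => ⟨Finset.mem_univ p, fun hp => h0 ?_, h⟩, fun h => h.2.2⟩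
      rwa [show (⟨0, hn⟩ : Fin n) = p from Fin.ext hp.symm]
    obtain ⟨p, hp⟩ := exists_eq_lam_circ a
    have hne : P.Nonempty := ⟨p, (hP p).1 ((hb1 p).2 hp)⟩
    refine ⟨hne, ?_⟩
    have hm := P.max'_mem hne
    have hmax (p) (hp : p ∈ P) : p ≤ P.max' hne := P.le_max' p hp
    change per = gcdPeriod P (P.max' hne)
    obtain ⟨T, hT⟩ := hper2
    refine le_antisymm (hmin _ (gcdPeriod_pos _ _) ⟨n * n, fun t ht => ?_⟩)
      (Nat.le_of_dvd hper1 (dvd_of_eventually_convPow_add_eq hb hP hm hmax hT))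
    exact convPow_add_of_nsmul_mem hb ((hP _).2 hm) (gcdPeriod_nsmul_mem hmax fun p hp =>
      sub_mem_lateStabilizer hb ((hP _).2 hm) ((hP p).2 hp)) ht
end

section
/- Let n ≥ 1, let 𝐗 ⊆ ℝ≥0^n be an interval with bound vectors x̲, x̄, and let C(𝐚) be an interval circulant matrix. Then every A ∈ C(𝐚) satisfies 𝐗 ⊆ Attr(A) (i.e., C(𝐚) is universally 𝐗-robust) if and only if x^{(j)} ∈ Attr(A^{(i)}) for all i ∈ {0,…,n−1} and all j ∈ {1,…,n}. -/
open scoped NNReal Classical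

namespace MaxAlg

variable {n : ℕ}

/-- The max-algebraic action of the circulant matrix with values `a` on a vector. -/
noncomputable def act (a x : Fin n → ℝ≥0) : Fin n → ℝ≥0 :=
  fun i => Finset.univ.sup fun t => a t * x (i + t)

/-- The cyclic shift of a vector by `t`. -/
def shift (t : Fin n) (x : Fin n → ℝ≥0) : Fin n → ℝ≥0 := fun i => x (i + t)

theorem mvec_mId (x : Fin n → ℝ≥0) : mvec (mId n) x = x := by
  funext i
  apply le_antisymm
  · refine Finset.sup_le fun j _ => ?_
    by_cases h : i = j <;> simp [mId, h]
  · simpa [mId, mvec] using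
      Finset.le_sup (f := fun j => mId n i j * x j) (Finset.mem_univ i)

theorem mvec_mmul (A B : Matrix (Fin n) (Fin n) ℝ≥0) (x : Fin n → ℝ≥0) :
    mvec (mmul A B) x = mvec A (mvec B x) := by
  funext i
  simp only [mvec, mmul, NNReal.finset_sup_mul, NNReal.mul_finset_sup]
  rw [Finset.sup_comm]
  simp only [mul_assoc]

theorem act_mono {a b x y : Fin n → ℝ≥0} (hab : a ≤ b) (hxy : x ≤ y) : act a x ≤ act b y :=
  fun i => Finset.sup_mono_fun fun t _ => mul_le_mul' (hab t) (hxy (i + t))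

theorem act_iterate_mono {a b x y : Fin n → ℝ≥0} (hab : a ≤ b) (hxy : x ≤ y) (s : ℕ) :
    (act a)^[s] x ≤ (act b)^[s] y := by
  induction s generalizing x y with
  | zero => exact hxy
  | succ s ih => exact ih (act_mono hab hxy)

theorem act_smul (a x : Fin n → ℝ≥0) (c : ℝ≥0) : act a (c • x) = c • act a x := by
  funext i
  simp only [act, Pi.smul_apply, smul_eq_mul, NNReal.mul_finset_sup]
  exact Finset.sup_congr rfl fun t _ => mul_left_comm _ _ _

theorem smul_act (a x : Fin n → ℝ≥0) (c : ℝ≥0) : act (c • a) x = c • act a x := by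
  funext i
  simp only [act, Pi.smul_apply, smul_eq_mul, NNReal.mul_finset_sup, mul_assoc]

theorem act_iterate_smul (a x : Fin n → ℝ≥0) (c : ℝ≥0) (s : ℕ) :
    (act a)^[s] (c • x) = c • (act a)^[s] x :=
  (show Function.Commute (act a) (c • ·) from fun y => act_smul a y c).iterate_left s x

theorem act_shift (a x : Fin n → ℝ≥0) (t : Fin n) : act a (shift t x) = shift t (act a x) := by
  funext i
  simp only [act, shift, add_right_comm]

theorem act_iterate_shift (a x : Fin n → ℝ≥0) (t : Fin n) (s : ℕ) :
    (act a)^[s] (shift t x) = shift t ((act a)^[s] x) :=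
  (show Function.Commute (act a) (shift t) from fun y => act_shift a y t).iterate_left s x

theorem smul_shift_le_act (a x : Fin n → ℝ≥0) (t : Fin n) : a t • shift t x ≤ act a x :=
  fun i => Finset.le_sup (f := fun t => a t * x (i + t)) (Finset.mem_univ t)

theorem sup_eq_of_forall_le {a : Fin n → ℝ≥0} {m : Fin n} (hm : ∀ t, a t ≤ a m) :
    Finset.univ.sup a = a m :=
  le_antisymm (Finset.sup_le fun t _ => hm t) (Finset.le_sup (Finset.mem_univ m))

theorem act_iterate_eq_smul_of_le {a x : Fin n → ℝ≥0} {c : ℝ≥0} {s r : ℕ}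
    (h : (act a)^[s + 1] x = c • (act a)^[s] x) (hr : s ≤ r) :
    (act a)^[r + 1] x = c • (act a)^[r] x := by
  obtain ⟨k, rfl⟩ := Nat.exists_eq_add_of_le' hr
  rw [add_assoc, Function.iterate_add_apply, h, act_iterate_smul, Function.iterate_add_apply]

theorem act_finset_sup {ι : Type*} (a : Fin n → ℝ≥0) (J : Finset ι) (v : ι → Fin n → ℝ≥0) :
    act a (J.sup v) = J.sup fun j => act a (v j) := by
  funext i
  simp only [act, Finset.sup_apply, NNReal.mul_finset_sup]
  rw [Finset.sup_comm]

theorem act_iterate_finset_sup {ι : Type*} (a : Fin n → ℝ≥0) (J : Finset ι)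
    (v : ι → Fin n → ℝ≥0) (s : ℕ) :
    (act a)^[s] (J.sup v) = J.sup fun j => (act a)^[s] (v j) := by
  induction s with
  | zero => rfl
  | succ s ih => simp only [Function.iterate_succ_apply', ih, act_finset_sup]

theorem div_mul_vtx_le {lo hi x : Fin n → ℝ≥0} (hlo : lo ≤ x) (hhi : x ≤ hi) (j : Fin n) :
    (x j / hi j) • vtx lo hi j ≤ x ∧ ((x j / hi j) • vtx lo hi j) j = x j := by
  have hj : ((x j / hi j) • vtx lo hi j) j = x j := by
    have h0 : hi j = 0 → x j = 0 := fun h => le_antisymm ((hhi j).trans_eq h) zero_le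
    simpa [vtx] using div_mul_cancel_of_imp h0
  refine ⟨fun i => ?_, hj⟩
  by_cases hij : i = j
  · rw [hij, hj]
  · have hc : x j / hi j ≤ 1 := div_le_one_of_le₀ (hhi j) zero_le
    calc ((x j / hi j) • vtx lo hi j) i = x j / hi j * lo i := by simp [vtx, hij]
      _ ≤ 1 * lo i := by gcongr
      _ ≤ x i := by simpa using hlo i

theorem sup_vtx_eq {lo hi x : Fin n → ℝ≥0} (hlo : lo ≤ x) (hhi : x ≤ hi) :
    (Finset.univ.sup fun j => (x j / hi j) • vtx lo hi j) = x := by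
  apply le_antisymm
  · exact Finset.sup_le fun j _ => (div_mul_vtx_le hlo hhi j).1
  · intro j
    have h := Finset.le_sup (f := fun j => (x j / hi j) • vtx lo hi j) (Finset.mem_univ j) j
    exact (div_mul_vtx_le hlo hhi j).2.symm.trans_le h

theorem IsIntervalFam.mem_Icc {S : Fin n → Set ℝ≥0} {lo hi : Fin n → ℝ≥0}
    (hS : IsIntervalFam S lo hi) {i : Fin n} {y : ℝ≥0} (hy : y ∈ S i) :
    lo i ≤ y ∧ y ≤ hi i := by
  rcases (hS i).2 with h | h | h | h <;> rw [h] at hy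
  · exact hy
  · exact ⟨hy.1, hy.2.le⟩
  · exact ⟨hy.1.le, hy.2⟩
  · exact ⟨hy.1.le, hy.2.le⟩

theorem IsIntervalFam.closure_eq {S : Fin n → Set ℝ≥0} {lo hi : Fin n → ℝ≥0}
    (hS : IsIntervalFam S lo hi) (i : Fin n) :
    lo i ≤ hi i ∧ closure (S i) = Set.Icc (lo i) (hi i) := by
  obtain ⟨⟨y, hy⟩, h⟩ := hS i
  refine ⟨(hS.mem_Icc hy).1.trans (hS.mem_Icc hy).2, ?_⟩
  rcases h with h | h | h | h <;> rw [h] at hy ⊢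
  · exact isClosed_Icc.closure_eq
  · exact closure_Ico (hy.1.trans_lt hy.2).ne
  · exact closure_Ioc (hy.1.trans_le hy.2).ne
  · exact closure_Ioo (hy.1.trans hy.2).ne

theorem IsIntervalFam.vtx_mem_closure {S : Fin n → Set ℝ≥0} {lo hi : Fin n → ℝ≥0}
    (hS : IsIntervalFam S lo hi) (j : Fin n) : vtx lo hi j ∈ closure (Set.univ.pi S) := by
  rw [closure_pi_set]
  intro i _
  change _ ∈ closure (S i)
  rw [(hS.closure_eq i).2]
  have hle := (hS.closure_eq i).1
  by_cases hij : i = j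
  · subst hij
    simpa [vtx] using hle
  · simpa [vtx, hij] using hle

variable [NeZero n]

theorem mvec_circ (a x : Fin n → ℝ≥0) : mvec (circ a) x = act a x := by
  funext i
  apply le_antisymm
  · refine Finset.sup_le fun j _ => ?_
    simpa [circ, mvec, act] using
      Finset.le_sup (f := fun t => a t * x (i + t)) (Finset.mem_univ (j - i))
  · refine Finset.sup_le fun t _ => ?_
    simpa [circ, mvec, act] using
      Finset.le_sup (f := fun j => circ a i j * x j) (Finset.mem_univ (i + t))

theorem mvec_mpow_circ (a x : Fin n → ℝ≥0) (s : ℕ) :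
    mvec (mpow (circ a) s) x = (act a)^[s] x := by
  induction s generalizing x with
  | zero => exact mvec_mId x
  | succ s ih => rw [mpow, mvec_mmul, mvec_circ, ih, Function.iterate_succ_apply]

theorem lam_circ (a : Fin n → ℝ≥0) : lam (circ a) = Finset.univ.sup a := by
  have hn : n ≠ 0 := NeZero.ne n
  apply le_antisymm
  · refine Finset.sup_le fun k hk => Finset.sup_le fun c _ => ?_
    have hk0 : k ≠ 0 := by have := (Finset.mem_Icc.1 hk).1; omega
    calc cycMean (circ a) k c
        ≤ ((Finset.univ.sup a) ^ k) ^ ((1 : ℝ) / k) := by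
          refine NNReal.rpow_le_rpow ?_ (by positivity)
          calc ∏ l : Fin k, circ a (c l) (c (cyc l))
              ≤ ∏ _l : Fin k, Finset.univ.sup a :=
                Finset.prod_le_prod' fun l _ => Finset.le_sup (f := a) (Finset.mem_univ _)
            _ = _ := by simp
      _ = Finset.univ.sup a := by
          rw [one_div, NNReal.pow_rpow_inv_natCast _ hk0]
  · refine Finset.sup_le fun t _ => ?_
    have hnt : n • t = 0 := by simpa using card_nsmul_eq_zero (x := t)
    have hstep (l : Fin n) : (cyc l).val • t - l.val • t = t := by
      have h : (cyc l).val • t = (l.val + 1) • t := by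
        conv_rhs => rw [← Nat.mod_add_div (l.val + 1) n, add_nsmul, mul_nsmul, hnt]
        simp [cyc]
      rw [h, succ_nsmul, add_sub_cancel_left]
    have hmean : cycMean (circ a) n (fun l : Fin n => l.val • t) = a t := by
      have hprod : ∏ l : Fin n, circ a (l.val • t) ((cyc l).val • t) = a t ^ n := by
        calc _ = ∏ _l : Fin n, a t :=
              Finset.prod_congr rfl fun l _ => congrArg a (hstep l)
          _ = _ := by simp
      rw [cycMean, hprod, one_div, NNReal.pow_rpow_inv_natCast _ hn]
    rw [← hmean]
    exact (Finset.le_sup (f := fun c => cycMean (circ a) n c) (Finset.mem_univ _)).trans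
      (Finset.le_sup (f := fun k => Finset.univ.sup fun c : Fin k → Fin n => cycMean (circ a) k c)
        (Finset.mem_Icc.2 ⟨Nat.one_le_iff_ne_zero.2 hn, le_rfl⟩))

theorem mem_Attr_circ {a x : Fin n → ℝ≥0} :
    x ∈ Attr (circ a) ↔
      ∃ s : ℕ, (act a)^[s + 1] x = Finset.univ.sup a • (act a)^[s] x := by
  simp only [Attr, Set.mem_ofPred_eq, mvec_mpow_circ, lam_circ]
  rfl

theorem prod_mul_le_act_iterate (a x : Fin n → ℝ≥0) (M : Multiset (Fin n)) (i : Fin n) :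
    (M.map a).prod * x (i + M.sum) ≤ (act a)^[M.card] x i := by
  induction M using Multiset.induction_on generalizing i with
  | empty => simp
  | cons t M ih =>
    rw [Multiset.card_cons, Function.iterate_succ_apply']
    refine le_trans ?_ (smul_shift_le_act a _ t i)
    simpa [shift, mul_assoc, add_assoc] using mul_le_mul_right (ih (i + t)) (a t)

theorem exists_multiset_act_iterate_eq (a x : Fin n → ℝ≥0) (s : ℕ) (i : Fin n) :
    ∃ M : Multiset (Fin n), M.card = s ∧ (act a)^[s] x i = (M.map a).prod * x (i + M.sum) := by
  induction s generalizing i with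
  | zero => exact ⟨0, by simp⟩
  | succ s ih =>
    obtain ⟨t, -, ht⟩ := Finset.exists_mem_eq_sup Finset.univ Finset.univ_nonempty
      fun t => a t * (act a)^[s] x (i + t)
    obtain ⟨M, hM, hx⟩ := ih (i + t)
    refine ⟨t ::ₘ M, by simp [hM], ?_⟩
    rw [Function.iterate_succ_apply', act, ht, hx]
    simp [mul_assoc, add_assoc]

theorem exists_replicate_le {M : Multiset (Fin n)} (hM : n * n ≤ M.card) :
    ∃ t, Multiset.replicate n t ≤ M := by
  by_contra! h
  have hcount (t : Fin n) : M.count t < n := by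
    by_contra! hle
    exact h t (Multiset.le_count_iff_replicate_le.1 hle)
  have hsum : ∑ t : Fin n, M.count t = M.card := Multiset.sum_count_eq_card (by simp)
  have hlt : ∑ t : Fin n, M.count t < ∑ _t : Fin n, n :=
    Finset.sum_lt_sum_of_nonempty Finset.univ_nonempty fun t _ => hcount t
  simp at hlt
  omega

/-- Past the uniform transient `n * n`, one step of the action of a circulant matrix is the shift
along a maximal value: in an optimal walk, `n` copies of any step can be traded for `n` copies of
the maximal one. -/
theorem act_iterate_succ_eq {a : Fin n → ℝ≥0} {m : Fin n} (hm : ∀ t, a t ≤ a m)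
    (x : Fin n → ℝ≥0) {s : ℕ} (hs : n * n ≤ s) :
    (act a)^[s + 1] x = a m • shift m ((act a)^[s] x) := by
  apply le_antisymm
  · intro i
    obtain ⟨M, hM, hx⟩ := exists_multiset_act_iterate_eq a x (s + 1) i
    obtain ⟨t, ht⟩ := exists_replicate_le (M := M) (by omega)
    obtain ⟨R, rfl⟩ := Multiset.le_iff_exists_add.1 ht
    have hnt (u : Fin n) : n • u = 0 := by simpa using card_nsmul_eq_zero (x := u)
    obtain ⟨k, hk⟩ : ∃ k, n = k + 1 := Nat.exists_eq_succ_of_ne_zero (NeZero.ne n)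
    have hcard : (Multiset.replicate k m + R).card = s := by
      simp only [Multiset.card_add, Multiset.card_replicate] at hM ⊢
      omega
    have hkm : m + k • m = 0 := by rw [← succ_nsmul', ← hk, hnt]
    have key := prod_mul_le_act_iterate a x (Multiset.replicate k m + R) (i + m)
    have hsum : i + m + (Multiset.replicate k m + R).sum = i + R.sum := by
      rw [Multiset.sum_add, Multiset.sum_replicate, ← add_assoc, add_assoc i, hkm, add_zero]
    rw [hcard, hsum] at key
    simp only [Multiset.map_add, Multiset.prod_add, Multiset.map_replicate,
      Multiset.prod_replicate, Multiset.sum_add, Multiset.sum_replicate, hnt, zero_add] at hx key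
    calc (act a)^[s + 1] x i = a t ^ n * (R.map a).prod * x (i + R.sum) := hx
      _ ≤ a m ^ n * (R.map a).prod * x (i + R.sum) := by gcongr; exact hm t
      _ = a m * (a m ^ k * (R.map a).prod * x (i + R.sum)) := by
          rw [show a m ^ n = a m ^ (k + 1) from congrArg _ hk]; ring
      _ ≤ a m * (act a)^[s] x (i + m) := by gcongr
  · rw [Function.iterate_succ_apply']
    exact smul_shift_le_act a _ m

theorem act_iterate_add_eq {a : Fin n → ℝ≥0} {m : Fin n} (hm : ∀ t, a t ≤ a m)
    (x : Fin n → ℝ≥0) {s : ℕ} (hs : n * n ≤ s) (k : ℕ) :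
    (act a)^[s + k] x = a m ^ k • (shift m)^[k] ((act a)^[s] x) := by
  induction k with
  | zero => simp
  | succ k ih =>
    rw [← add_assoc, act_iterate_succ_eq hm x (by omega), ih, Function.iterate_succ_apply',
      pow_succ', mul_smul]
    rfl

theorem shift_injective (t : Fin n) : Function.Injective (shift t) := by
  intro x y h
  funext i
  simpa [shift] using congrFun h (i - t)

/-- `Attr` of a nonzero circulant matrix in terms of invariance under the shift along a maximal
value. -/
theorem mem_Attr_circ_iff_shift {a x : Fin n → ℝ≥0} {m : Fin n} (hm : ∀ t, a t ≤ a m)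
    (h0 : a m ≠ 0) :
    x ∈ Attr (circ a) ↔ shift m ((act a)^[n * n] x) = (act a)^[n * n] x := by
  rw [mem_Attr_circ, sup_eq_of_forall_le hm]
  have hinj : Function.Injective (a m • · : (Fin n → ℝ≥0) → _) := smul_right_injective _ h0
  constructor
  · rintro ⟨s, hs⟩
    have h := act_iterate_eq_smul_of_le hs (Nat.le_add_left s (n * n))
    rw [act_iterate_succ_eq hm x (Nat.le_add_right _ _)] at h
    have h' := hinj h
    have hcomm : ∀ c : ℝ≥0, ∀ y : Fin n → ℝ≥0, shift m (c • y) = c • shift m y := fun _ _ => rfl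
    rw [act_iterate_add_eq hm x le_rfl s, hcomm, ← Function.iterate_succ_apply' (shift m),
      Function.iterate_succ_apply] at h'
    exact (shift_injective m).iterate s (smul_right_injective _ (pow_ne_zero s h0) h')
  · intro h
    exact ⟨n * n, by rw [act_iterate_succ_eq hm x le_rfl, h]⟩

theorem exists_forall_le (a : Fin n → ℝ≥0) : ∃ m, ∀ t, a t ≤ a m := by
  obtain ⟨m, -, h⟩ := Finset.exists_max_image Finset.univ a Finset.univ_nonempty
  exact ⟨m, fun t => h t (Finset.mem_univ t)⟩

theorem mem_Attr_circ_of_eq_zero {a x : Fin n → ℝ≥0} (ha : ∀ t, a t = 0) : x ∈ Attr (circ a) := by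
  refine mem_Attr_circ.2 ⟨0, ?_⟩
  have hsup : Finset.univ.sup a = 0 := (sup_eq_of_forall_le (m := 0) (by simp [ha])).trans (ha 0)
  funext i
  have hact : act a x i ≤ 0 := Finset.sup_le fun t _ => by simp [ha]
  simpa [hsup] using hact

/-- Membership in `Attr` of a circulant matrix is decided after `n * n` steps. -/
theorem mem_Attr_circ_iff {a x : Fin n → ℝ≥0} :
    x ∈ Attr (circ a) ↔
      (act a)^[n * n + 1] x = Finset.univ.sup a • (act a)^[n * n] x := by
  refine ⟨fun h => ?_, fun h => mem_Attr_circ.2 ⟨_, h⟩⟩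
  obtain ⟨m, hm⟩ := exists_forall_le a
  rw [sup_eq_of_forall_le hm, act_iterate_succ_eq hm x le_rfl]
  by_cases h0 : a m = 0
  · simp [h0]
  · rw [(mem_Attr_circ_iff_shift hm h0).1 h]

/-- Enlarging the values of a circulant matrix without exceeding its maximum enlarges `Attr`. -/
theorem Attr_circ_subset {b d : Fin n → ℝ≥0} {m : Fin n} (hbd : b ≤ d) (hd : ∀ t, d t ≤ d m)
    (hmax : b m = d m) : Attr (circ b) ⊆ Attr (circ d) := by
  intro x hx
  by_cases h0 : d m = 0
  · exact mem_Attr_circ_of_eq_zero fun t => le_antisymm ((hd t).trans_eq h0) zero_le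
  have hb (t : Fin n) : b t ≤ b m := (hbd t).trans ((hd t).trans_eq hmax.symm)
  have hinv := (mem_Attr_circ_iff_shift hb (hmax ▸ h0)).1 hx
  have hcollapse : (act d)^[n * n + n * n] x = (act d)^[n * n] ((act b)^[n * n] x) := by
    apply le_antisymm
    · have hpow (k : ℕ) : b m ^ k • (shift m)^[k] x ≤ (act b)^[k] x := by
        induction k with
        | zero => simp
        | succ k ih =>
          rw [Function.iterate_succ_apply', Function.iterate_succ_apply']
          refine le_trans ?_ (act_mono le_rfl ih)
          rw [act_smul, pow_succ, mul_smul]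
          exact smul_le_smul_of_nonneg_left (smul_shift_le_act b _ m) zero_le
      have hcomm : (shift m)^[n * n] ((act d)^[n * n] x) = (act d)^[n * n] ((shift m)^[n * n] x) :=
        ((show Function.Commute (act d) (shift m) from
          fun y => act_shift d y m).iterate_iterate (n * n) (n * n) x).symm
      rw [act_iterate_add_eq hd x le_rfl, hcomm, ← act_iterate_smul, ← hmax]
      exact act_iterate_mono le_rfl (hpow _) _
    · rw [Function.iterate_add_apply]
      exact act_iterate_mono le_rfl (act_iterate_mono hbd le_rfl _) _
  refine mem_Attr_circ.2 ⟨n * n + n * n, ?_⟩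
  rw [act_iterate_succ_eq hd x (Nat.le_add_right _ _), sup_eq_of_forall_le hd, hcollapse,
    ← act_iterate_shift, hinv]

theorem finset_sup_mem_Attr_circ {ι : Type*} {a : Fin n → ℝ≥0} {J : Finset ι}
    {v : ι → Fin n → ℝ≥0} (hv : ∀ j ∈ J, v j ∈ Attr (circ a)) : J.sup v ∈ Attr (circ a) := by
  rw [mem_Attr_circ_iff, act_iterate_finset_sup, act_iterate_finset_sup]
  funext i
  simp only [Finset.sup_apply, Pi.smul_apply, smul_eq_mul, NNReal.mul_finset_sup]
  exact Finset.sup_congr rfl fun j hj => congrFun (mem_Attr_circ_iff.1 (hv j hj)) i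

theorem smul_mem_Attr_circ {a x : Fin n → ℝ≥0} (hx : x ∈ Attr (circ a)) (c : ℝ≥0) :
    c • x ∈ Attr (circ a) := by
  rw [mem_Attr_circ_iff, act_iterate_smul, act_iterate_smul, mem_Attr_circ_iff.1 hx, smul_comm]

theorem Attr_circ_subset_smul (a : Fin n → ℝ≥0) (c : ℝ≥0) :
    Attr (circ a) ⊆ Attr (circ (c • a)) := by
  intro x hx
  have hiter (s : ℕ) : (act (c • a))^[s] x = c ^ s • (act a)^[s] x := by
    induction s with
    | zero => simp
    | succ s ih =>
      rw [Function.iterate_succ_apply', ih, smul_act, act_smul, Function.iterate_succ_apply',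
        pow_succ', mul_smul]
  have hsup : Finset.univ.sup (c • a) = c * Finset.univ.sup a := (NNReal.mul_finset_sup _ _ _).symm
  rw [mem_Attr_circ_iff, hiter, hiter, mem_Attr_circ_iff.1 hx, hsup, pow_succ, smul_smul,
    smul_smul]
  congr 1
  ring

theorem isClosed_setOf_mem_Attr_circ :
    IsClosed {p : (Fin n → ℝ≥0) × (Fin n → ℝ≥0) | p.2 ∈ Attr (circ p.1)} := by
  have hiter (s : ℕ) : Continuous fun p : (Fin n → ℝ≥0) × (Fin n → ℝ≥0) => (act p.1)^[s] p.2 := by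
    induction s with
    | zero => exact continuous_snd
    | succ s ih =>
      simp only [Function.iterate_succ_apply']
      refine continuous_pi fun i => Continuous.finset_sup_apply fun t _ => ?_
      fun_prop
  have hsup : Continuous fun p : (Fin n → ℝ≥0) × (Fin n → ℝ≥0) => Finset.univ.sup p.1 :=
    Continuous.finset_sup_apply fun t _ => by fun_prop
  simp only [mem_Attr_circ_iff]
  exact isClosed_eq (hiter _) (hsup.smul (hiter _))

end MaxAlg

open MaxAlg in
/-- `C(𝐚)` is universally `𝐗`-robust iff `x⁽ʲ⁾ ∈ Attr(A⁽ⁱ⁾)` for all `i, j`. -/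
theorem universally_X_robust_iff
    (n : ℕ) (hn : 1 ≤ n)
    (S : Fin n → Set ℝ≥0) (lo hi : Fin n → ℝ≥0) (hS : IsIntervalFam S lo hi)
    (Sa : Fin n → Set ℝ≥0) (alo ahi : Fin n → ℝ≥0) (hSa : IsIntervalFam Sa alo ahi)
    (hle : ∀ k, alo k ≤ ahi k) :
    (∀ A ∈ Cset Sa, ∀ x ∈ box S, x ∈ Attr A) ↔
      ∀ i j : Fin n, vtx lo hi j ∈ Attr (Ak alo ahi i) := by
  have : NeZero n := ⟨by omega⟩
  constructor
  · intro h i j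
    have hmem : (vtx alo ahi i, vtx lo hi j) ∈ closure (Set.univ.pi Sa ×ˢ Set.univ.pi S) := by
      rw [closure_prod_eq]
      exact ⟨hSa.vtx_mem_closure i, hS.vtx_mem_closure j⟩
    have hsub : Set.univ.pi Sa ×ˢ Set.univ.pi S ⊆
        {p : (Fin n → ℝ≥0) × (Fin n → ℝ≥0) | p.2 ∈ Attr (circ p.1)} := by
      rintro ⟨a, x⟩ ⟨ha, hx⟩
      exact h (circ a) ⟨a, fun k => ha k (Set.mem_univ k), rfl⟩ x fun k => hx k (Set.mem_univ k)
    have hvtx := closure_minimal hsub isClosed_setOf_mem_Attr_circ hmem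
    rwa [Set.mem_ofPred_eq] at hvtx
  · rintro h _ ⟨a, ha, rfl⟩ x hx
    obtain ⟨m, hm⟩ := exists_forall_le a
    obtain ⟨hle', heq⟩ := div_mul_vtx_le (fun k => (hSa.mem_Icc (ha k)).1)
      (fun k => (hSa.mem_Icc (ha k)).2) m
    rw [← sup_vtx_eq (fun k => (hS.mem_Icc (hx k)).1) (fun k => (hS.mem_Icc (hx k)).2)]
    exact finset_sup_mem_Attr_circ fun j _ => smul_mem_Attr_circ
      (Attr_circ_subset hle' hm heq (Attr_circ_subset_smul _ _ (h m j))) _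
end
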